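/- arXiv:2109.05702 — 4 statements merged into one kernel-verified Lean document; each statement's English description precedes it below -/
import Mathlib

section
/- Let λ_w > 0, λ_b > 0 and μ > λ_w + λ_b. Set p = μ/(λ_w+μ), q = μ/(λ_b+λ_w+μ), and for u ∈ ℝ let r(u) = p^u·q^(1−u) + (1−p)^u·(1−q)^(1−u). Define a = (λ_b+λ_w)/μ, b = (λ_b+λ_w)/λ_w, c = (λ_w+μ)/(λ_b+λ_w+μ), and v = log(a·log(b·c)/log(1/c)) / log b. Then 0 < v < 1, r(v) ≤ r(u) for every u ∈ [0,1], and consequently the error exponent I_err := −min_{0≤u≤1} log r(u) equals −log(p^v·q^(1−v) + (1−p)^v·(1−q)^(1−v)). -/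
open Real Set

lemma rpow_mul_rpow_one_sub_eq_mul_exp {x y : ℝ} (hx : 0 < x) (hy : 0 < y) (u : ℝ) :
    x ^ u * y ^ (1 - u) = y * Real.exp (u * Real.log (x / y)) := by
  have e : Real.exp (u * Real.log (x / y)) = x ^ u / y ^ u := by
    rw [mul_comm, ← Real.rpow_def_of_pos (div_pos hx hy), Real.div_rpow hx.le hy.le]
  rw [e, Real.rpow_sub hy, Real.rpow_one]
  ring

/-- A critical point of `u ↦ s * exp (u * A) + t * exp (-(u * B))` is a global minimum. -/
lemma add_exp_le_of_critical {s t A B v : ℝ} (hs : 0 < s) (ht : 0 < t)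
    (h : s * A * Real.exp (v * A) = t * B * Real.exp (-(v * B))) (u : ℝ) :
    s * Real.exp (v * A) + t * Real.exp (-(v * B)) ≤
      s * Real.exp (u * A) + t * Real.exp (-(u * B)) := by
  have h1 : Real.exp (u * A) = Real.exp (v * A) * Real.exp ((u - v) * A) := by
    rw [← Real.exp_add]; ring_nf
  have h2 : Real.exp (-(u * B)) = Real.exp (-(v * B)) * Real.exp (-((u - v) * B)) := by
    rw [← Real.exp_add]; ring_nf
  have h3 := mul_le_mul_of_nonneg_left (Real.add_one_le_exp ((u - v) * A))
    (mul_pos hs (Real.exp_pos (v * A))).le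
  have h4 := mul_le_mul_of_nonneg_left (Real.add_one_le_exp (-((u - v) * B)))
    (mul_pos ht (Real.exp_pos (-(v * B)))).le
  rw [h1, h2]
  linear_combination h3 + h4 - (u - v) * h

/-- Location of the minimizer of the Chernoff sum of two Bernoulli laws. -/
lemma bernoulli_chernoff_minimizer {p q A B v : ℝ} (hq : 0 < q) (hqp : q < p) (hp : p < 1)
    (hA : A = Real.log (p / q)) (hB : B = Real.log ((1 - q) / (1 - p)))
    (hv : v = Real.log ((1 - q) / q * B / A) / (A + B)) :
    0 < v ∧ v < 1 ∧ ∀ u : ℝ, p ^ v * q ^ (1 - v) + (1 - p) ^ v * (1 - q) ^ (1 - v) ≤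
      p ^ u * q ^ (1 - u) + (1 - p) ^ u * (1 - q) ^ (1 - u) := by
  have hp0 : 0 < p := hq.trans hqp
  have hp1 : 0 < 1 - p := by linarith
  have hq1 : 0 < 1 - q := by linarith
  have hA0 : 0 < A := hA ▸ Real.log_pos ((one_lt_div hq).2 hqp)
  have hB0 : 0 < B := hB ▸ Real.log_pos ((one_lt_div hp1).2 (by linarith))
  have hlog : ∀ {x y : ℝ}, 0 < x → 0 < y → x ≠ y → y * Real.log (x / y) < x - y := by
    intro x y hx hy hxy
    have h := mul_lt_mul_of_pos_left (Real.log_lt_sub_one_of_pos (div_pos hx hy)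
      (fun h => hxy ((div_eq_one_iff_eq hy.ne').1 h))) hy
    have e : y * (x / y - 1) = x - y := by field_simp
    linarith
  have hA' : Real.log (q / p) = -A := by rw [hA, ← Real.log_inv, inv_div]
  have hB' : Real.log ((1 - p) / (1 - q)) = -B := by rw [hB, ← Real.log_inv, inv_div]
  have i1 := hlog hp0 hq hqp.ne'
  have i2 := hlog hq hp0 hqp.ne
  have i3 := hlog hq1 hp1 (by linarith)
  have i4 := hlog hp1 hq1 (by linarith)
  rw [← hA] at i1
  rw [hA'] at i2
  rw [← hB] at i3
  rw [hB'] at i4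
  have hx0 : 0 < (1 - q) / q * B / A := by positivity
  have hx1 : 1 < (1 - q) / q * B / A := by
    rw [one_lt_div hA0, div_mul_eq_mul_div, lt_div_iff₀ hq]
    linarith
  have hAB : Real.exp (A + B) = p / q * ((1 - q) / (1 - p)) := by
    rw [Real.exp_add, hA, hB, Real.exp_log (by positivity), Real.exp_log (by positivity)]
  have hvm : v * (A + B) = Real.log ((1 - q) / q * B / A) := by
    rw [hv]; field_simp
  refine ⟨hv ▸ div_pos (Real.log_pos hx1) (by positivity), ?_, fun u => ?_⟩
  · rw [hv, div_lt_one (by positivity), Real.log_lt_iff_lt_exp hx0, hAB, div_lt_iff₀ hA0]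
    have h : (1 - p) * B < p * A := by linarith
    have e1 : (1 - q) / q * B = (1 - q) / (q * (1 - p)) * ((1 - p) * B) := by field_simp
    have e2 : p / q * ((1 - q) / (1 - p)) * A = (1 - q) / (q * (1 - p)) * (p * A) := by
      field_simp
    rw [e1, e2]
    exact mul_lt_mul_of_pos_left h (by positivity)
  · have hexp : Real.exp (v * A) = (1 - q) / q * B / A * Real.exp (-(v * B)) := by
      rw [← Real.exp_log hx0, ← hvm, ← Real.exp_add]
      ring_nf
    have hcrit : q * A * Real.exp (v * A) = (1 - q) * B * Real.exp (-(v * B)) := by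
      rw [hexp]; field_simp
    have h := add_exp_le_of_critical hq hq1 hcrit u
    simpa only [rpow_mul_rpow_one_sub_eq_mul_exp hp0 hq,
      rpow_mul_rpow_one_sub_eq_mul_exp hp1 hq1, hB', ← hA, mul_neg] using h

theorem stmt_0 (lw lb mu : ℝ) (hw : 0 < lw) (hb : 0 < lb) (hmu : lw + lb < mu)
    (p q a b c v : ℝ) (r : ℝ → ℝ)
    (hp : p = mu / (lw + mu)) (hq : q = mu / (lb + lw + mu))
    (hr : r = fun u : ℝ => p ^ u * q ^ (1 - u) + (1 - p) ^ u * (1 - q) ^ (1 - u))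
    (ha : a = (lb + lw) / mu) (hbb : b = (lb + lw) / lw)
    (hc : c = (lw + mu) / (lb + lw + mu))
    (hv : v = Real.log (a * Real.log (b * c) / Real.log (1 / c)) / Real.log b) :
    0 < v ∧ v < 1 ∧ (∀ u ∈ Icc (0 : ℝ) 1, r v ≤ r u) ∧
      (- sInf ((fun u => Real.log (r u)) '' Icc (0 : ℝ) 1)
        = - Real.log (p ^ v * q ^ (1 - v) + (1 - p) ^ v * (1 - q) ^ (1 - v))) := by
  have hm : 0 < mu := by linarith
  have hp1 : 1 - p = lw / (lw + mu) := by rw [hp]; field_simp; ring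
  have hq1 : 1 - q = (lb + lw) / (lb + lw + mu) := by rw [hq]; field_simp; ring
  have hq0 : 0 < q := by rw [hq]; positivity
  have hp0 : 0 < p := by rw [hp]; positivity
  have hp1' : 0 < 1 - p := by rw [hp1]; positivity
  have hq1' : 0 < 1 - q := by rw [hq1]; positivity
  have hqp : q < p := by
    rw [hp, hq]
    exact div_lt_div_of_pos_left hm (by positivity) (by linarith)
  have hc0 : 0 < c := by rw [hc]; positivity
  have hb0 : 0 < b := by rw [hbb]; positivity
  have e1 : 1 / c = p / q := by rw [hc, hp, hq]; field_simp
  have e2 : b * c = (1 - q) / (1 - p) := by rw [hbb, hc, hp1, hq1]; field_simp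
  have e3 : a = (1 - q) / q := by rw [ha, hq1, hq]; field_simp
  have e4 : Real.log b = Real.log (p / q) + Real.log ((1 - q) / (1 - p)) := by
    rw [← e1, ← e2, ← Real.log_mul (by positivity) (by positivity)]
    congr 1
    field_simp
  rw [e1, e2, e3, e4] at hv
  obtain ⟨hv0, hv1, hmin⟩ :=
    bernoulli_chernoff_minimizer hq0 hqp (by linarith) rfl rfl hv
  subst hr
  refine ⟨hv0, hv1, fun u _ => hmin u, ?_⟩
  congr 1
  refine IsLeast.csInf_eq ⟨⟨v, ⟨hv0.le, hv1.le⟩, rfl⟩, ?_⟩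
  rintro _ ⟨u, -, rfl⟩
  exact Real.log_le_log (by positivity) (hmin u)
end

section
/- Fix λ_w > 0 and μ > 0. For x > 0 define a(x) = (x+λ_w)/μ, b(x) = (x+λ_w)/λ_w, c(x) = (λ_w+μ)/(x+λ_w+μ), and v(x) = log(a(x)·log(b(x)·c(x))/log(1/c(x))) / log(b(x)). Then v(x) → 1/2 as x → 0 from the right. -/
open Real Filter

theorem hasDerivAt_log_add_div {A x : ℝ} (hA : 0 < A) (hx : 0 ≤ x) :
    HasDerivAt (fun y => Real.log ((y + A) / A)) (1 / (x + A)) x := by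
  have hxA : 0 < x + A := by linarith
  have h := (((hasDerivAt_id' x).add_const A).div_const A).log (by positivity)
  convert h using 1
  field_simp

theorem tendsto_log_add_div_div {A : ℝ} (hA : 0 < A) :
    Tendsto (fun x => Real.log ((x + A) / A) / x) (nhdsWithin 0 (Set.Ioi 0)) (nhds (1 / A)) := by
  have h := (hasDerivAt_log_add_div hA le_rfl).tendsto_slope_zero_right
  simpa [hA.ne', div_eq_inv_mul] using h

theorem tendsto_add_mul_log_sub_div_sq {A : ℝ} (hA : 0 < A) :
    Tendsto (fun x => ((x + A) * Real.log ((x + A) / A) - x) / x ^ 2)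
      (nhdsWithin 0 (Set.Ioi 0)) (nhds (1 / (2 * A))) := by
  have hd : ∀ x : ℝ, 0 ≤ x → HasDerivAt (fun y => (y + A) * Real.log ((y + A) / A) - y)
      (Real.log ((x + A) / A)) x := by
    intro x hx
    have hxA : x + A ≠ 0 := by positivity
    have h := (((hasDerivAt_id' x).add_const A).mul (hasDerivAt_log_add_div hA hx)).sub
      (hasDerivAt_id' x)
    refine h.congr_deriv ?_
    rw [mul_one_div_cancel hxA]
    ring
  have hpos : ∀ᶠ x : ℝ in nhdsWithin 0 (Set.Ioi 0), 0 < x := self_mem_nhdsWithin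
  refine HasDerivAt.lhopital_zero_nhdsGT (f' := fun x => Real.log ((x + A) / A))
    (g' := fun x => 2 * x) ?_ ?_ ?_ ?_ ?_ ?_
  · filter_upwards [hpos] with x hx using hd x hx.le
  · filter_upwards with x
    simpa using hasDerivAt_pow 2 x
  · filter_upwards [hpos] with x hx
    positivity
  · have h := (hd 0 le_rfl).continuousAt.tendsto.mono_left
      (nhdsWithin_le_nhds (s := Set.Ioi (0 : ℝ)))
    simpa [hA.ne'] using h
  · have h : Continuous fun x : ℝ => x ^ 2 := by fun_prop
    simpa using (h.tendsto 0).mono_left (nhdsWithin_le_nhds (s := Set.Ioi (0 : ℝ)))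
  · have h := (tendsto_log_add_div_div hA).const_mul (1 / 2)
    convert h using 2
    · ring
    · field_simp

theorem tendsto_log_div_of_tendsto_sub_one_div {l : Filter ℝ} {F : ℝ → ℝ} {r : ℝ}
    (hl : l ≤ nhds 0) (hne : ∀ᶠ x in l, x ≠ 0)
    (hF : Tendsto (fun x => (F x - 1) / x) l (nhds r)) :
    Tendsto (fun x => Real.log (F x) / x) l (nhds r) := by
  have hF1 : Tendsto F l (nhds 1) := by
    have h := (hF.mul (tendsto_id'.2 hl)).add_const 1
    rw [mul_zero, zero_add] at h
    refine h.congr' ?_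
    filter_upwards [hne] with x hx
    simp only [id]
    field_simp
    ring
  have hc : ContinuousAt (dslope Real.log 1) 1 :=
    continuousAt_dslope_same.2 (Real.differentiableAt_log one_ne_zero)
  have h := (hc.tendsto.comp hF1).mul hF
  rw [dslope_same, Real.deriv_log, inv_one, one_mul] at h
  refine h.congr fun x => ?_
  have hs := sub_smul_dslope Real.log 1 (F x)
  rw [smul_eq_mul, Real.log_one, sub_zero] at hs
  rw [← hs, Function.comp_apply]
  ring

theorem stmt_10 (lw mu : ℝ) (hw : 0 < lw) (hmu : 0 < mu)
    (a b c v : ℝ → ℝ)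
    (ha : ∀ x, a x = (x + lw) / mu) (hb : ∀ x, b x = (x + lw) / lw)
    (hc : ∀ x, c x = (lw + mu) / (x + lw + mu))
    (hv : ∀ x, v x = Real.log (a x * Real.log (b x * c x) / Real.log (1 / c x))
        / Real.log (b x)) :
    Tendsto v (nhdsWithin 0 (Set.Ioi 0)) (nhds (1 / 2)) := by
  have hA : 0 < lw + mu := by positivity
  have hpos : ∀ᶠ x : ℝ in nhdsWithin 0 (Set.Ioi 0), 0 < x := self_mem_nhdsWithin
  have hF : Tendsto (fun x => (a x * Real.log (b x * c x) / Real.log (1 / c x) - 1) / x)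
      (nhdsWithin 0 (Set.Ioi 0)) (nhds (1 / (2 * lw))) := by
    have h := ((tendsto_add_mul_log_sub_div_sq hw).sub (tendsto_add_mul_log_sub_div_sq hA)).div
      ((tendsto_log_add_div_div hA).const_mul mu) (by positivity)
    have hval : (1 / (2 * lw) - 1 / (2 * (lw + mu))) / (mu * (1 / (lw + mu))) = 1 / (2 * lw) := by
      field_simp
      ring
    rw [hval] at h
    refine h.congr' ?_
    filter_upwards [hpos] with x hx
    have hlog : 0 < Real.log ((x + (lw + mu)) / (lw + mu)) :=
      Real.log_pos ((one_lt_div hA).2 (by linarith))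
    have hinv : 1 / c x = (x + (lw + mu)) / (lw + mu) := by
      rw [hc, one_div_div, add_assoc]
    have hbc : Real.log (b x * c x)
        = Real.log ((x + lw) / lw) - Real.log ((x + (lw + mu)) / (lw + mu)) := by
      rw [← Real.log_div (by positivity) (by positivity), hb, hc, ← add_assoc, div_div_eq_mul_div,
        mul_div_assoc]
    rw [hbc, hinv, ha, Pi.div_apply]
    generalize Real.log ((x + (lw + mu)) / (lw + mu)) = t at hlog
    generalize Real.log ((x + lw) / lw) = s
    field_simp
    ring
  have hL := tendsto_log_div_of_tendsto_sub_one_div nhdsWithin_le_nhds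
    (hpos.mono fun x hx => hx.ne') hF
  have h := hL.div (tendsto_log_add_div_div hw) (by positivity)
  have hval : 1 / (2 * lw) / (1 / lw) = 1 / 2 := by field_simp
  rw [hval] at h
  refine h.congr' ?_
  filter_upwards [hpos] with x hx
  rw [Pi.div_apply, hv, ← hb, div_div_div_cancel_right₀ hx.ne']
end

section
/- Fix λ_w > 0 and set μ = 1, p = 1/(λ_w+1). For x > 0 define q(x) = 1/(x+λ_w+1), v(x) = log((x+λ_w)·log(b(x)·c(x))/log(1/c(x)))/log(b(x)) with b(x) = (x+λ_w)/λ_w and c(x) = (λ_w+1)/(x+λ_w+1), and set F₁(x) = p^{v(x)}·q(x)^{1−v(x)} and F₂(x) = (1−p)^{v(x)}·(1−q(x))^{1−v(x)}. Then F₁ and F₂ are differentiable on a right neighborhood of 0, and F₁′(x) → −p²/2 and F₂′(x) → p²/2 as x → 0 from the right. -/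
open Real Filter

open scoped Topology

theorem AnalyticAt.exists_eq_add_mul {f : ℝ → ℝ} (hf : AnalyticAt ℝ f 0) :
    ∃ g : ℝ → ℝ, AnalyticAt ℝ g 0 ∧ g 0 = deriv f 0 ∧ ∀ x, f x = f 0 + x * g x := by
  obtain ⟨P, hP⟩ := hf
  refine ⟨dslope f 0, ⟨_, hP.has_fpower_series_dslope_fslope⟩, dslope_same f 0, fun x => ?_⟩
  have h := sub_smul_dslope f 0 x
  simp only [sub_zero, smul_eq_mul] at h
  rw [h]
  ring

/-- The function `log (1 + x) / x` extends analytically to `0`, with first-order jet `1 - x / 2`. -/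
theorem exists_analyticAt_log_one_add_eq_mul :
    ∃ g : ℝ → ℝ, AnalyticAt ℝ g 0 ∧ g 0 = 1 ∧ HasDerivAt g (-1 / 2) 0 ∧
      ∀ x, Real.log (1 + x) = x * g x := by
  have hlog : ∀ x : ℝ, 1 + x ≠ 0 → HasDerivAt (fun y => Real.log (1 + y)) (1 / (1 + x)) x :=
    fun x hx => ((hasDerivAt_id x).const_add 1).log hx
  have hf : AnalyticAt ℝ (fun x : ℝ => Real.log (1 + x)) 0 :=
    (analyticAt_const.add analyticAt_id).log (by simp)
  obtain ⟨g, hg, hg0, hfg⟩ := hf.exists_eq_add_mul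
  simp only [add_zero, Real.log_one, zero_add] at hfg
  rw [(hlog 0 (by simp)).deriv] at hg0
  refine ⟨g, hg, by simpa using hg0, ?_, hfg⟩
  have hne : ∀ᶠ x : ℝ in 𝓝 0, 1 + x ≠ 0 :=
    (continuousAt_const.add continuousAt_id).eventually_ne (by simp)
  have hderiv : (fun x => g x + x * deriv g x) =ᶠ[𝓝 0] fun x => (1 + x)⁻¹ := by
    filter_upwards [hne, hg.eventually_analyticAt] with x hx hgx
    have h := (hasDerivAt_id x).mul hgx.differentiableAt.hasDerivAt
    have hl := hlog x hx
    rw [show (fun y => Real.log (1 + y)) = id * g from funext hfg] at hl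
    have := h.unique hl
    simp only [id_eq, one_mul, one_div] at this
    exact this
  have h1 : HasDerivAt (fun x => g x + x * deriv g x)
      (deriv g 0 + (1 * deriv g 0 + 0 * deriv (deriv g) 0)) 0 :=
    hg.differentiableAt.hasDerivAt.add
      ((hasDerivAt_id (0 : ℝ)).mul hg.deriv.differentiableAt.hasDerivAt)
  have h2 : HasDerivAt (fun x : ℝ => (1 + x)⁻¹) (-1 / (1 + 0) ^ 2) 0 :=
    ((hasDerivAt_id (0 : ℝ)).const_add 1).inv (by simp)
  have h3 := (h1.congr_of_eventuallyEq hderiv.symm).unique h2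
  have h4 : deriv g 0 = -1 / 2 := by norm_num at h3; linarith
  exact h4 ▸ hg.differentiableAt.hasDerivAt

theorem AnalyticAt.real_rpow {f g : ℝ → ℝ} {x : ℝ} (hf : AnalyticAt ℝ f x)
    (hg : AnalyticAt ℝ g x) (hx : 0 < f x) : AnalyticAt ℝ (fun y => f y ^ g y) x := by
  refine ((hf.log hx).mul hg).rexp.congr ?_
  filter_upwards [hf.continuousAt.eventually_const_lt hx] with y hy
  exact (Real.rpow_def_of_pos hy _).symm

/-- A weighted geometric mean of a constant and an analytic function, with analytic weights. -/
theorem analyticAt_rpow_mul_rpow_one_sub {w r : ℝ → ℝ} {a r' : ℝ} (ha : 0 < a)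
    (hw : AnalyticAt ℝ w 0) (hr : AnalyticAt ℝ r 0) (hr0 : r 0 = a) (hr' : HasDerivAt r r' 0) :
    AnalyticAt ℝ (fun x => a ^ w x * r x ^ (1 - w x)) 0 ∧
      deriv (fun x => a ^ w x * r x ^ (1 - w x)) 0 = (1 - w 0) * r' := by
  have hrpos : 0 < r 0 := hr0 ▸ ha
  refine ⟨(AnalyticAt.real_rpow analyticAt_const hw ha).mul
    (hr.real_rpow (analyticAt_const.sub hw) hrpos), ?_⟩
  have hw' := hw.differentiableAt.hasDerivAt
  have h := (((hasDerivAt_const (0 : ℝ) a).rpow hw' ha)).mul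
    (hr'.rpow (hw'.const_sub 1) hrpos)
  refine h.deriv.trans ?_
  rw [hr0]
  have hmul : a ^ w 0 * a ^ (1 - w 0 - 1) = 1 := by
    rw [← Real.rpow_add ha]; simp
  linear_combination (r' * (1 - w 0)) * hmul

theorem tendsto_deriv_of_eventuallyEq_nhdsGT {F G : ℝ → ℝ} (hG : AnalyticAt ℝ G 0)
    (h : ∀ᶠ x in 𝓝[>] (0 : ℝ), F x = G x) :
    (∀ᶠ x in 𝓝[>] (0 : ℝ), DifferentiableAt ℝ F x) ∧
      Tendsto (deriv F) (𝓝[>] 0) (𝓝 (deriv G 0)) := by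
  have hloc : ∀ᶠ x in 𝓝[>] (0 : ℝ), F =ᶠ[𝓝 x] G := by
    filter_upwards [eventually_eventually_nhdsWithin.2 h, self_mem_nhdsWithin] with x hx hx0
    rwa [isOpen_Ioi.nhdsWithin_eq hx0] at hx
  refine ⟨?_, ?_⟩
  · filter_upwards [hloc, hG.eventually_analyticAt.filter_mono nhdsWithin_le_nhds] with x hx hGx
    exact hGx.differentiableAt.congr_of_eventuallyEq hx
  · refine (hG.deriv.continuousAt.tendsto.mono_left nhdsWithin_le_nhds).congr' ?_
    filter_upwards [hloc] with x hx
    exact hx.deriv_eq.symm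

/-- The exponent `log ((x + l) * (B - A) / A) / B`, where `B = log (1 + x / l)` and
`A = log (1 + x / (l + 1))`, extends analytically to `0` with value `1 / 2`. -/
theorem exists_analyticAt_exponent {l : ℝ} (hl : 0 < l) :
    ∃ w : ℝ → ℝ, AnalyticAt ℝ w 0 ∧ w 0 = 1 / 2 ∧ ∀ x, 0 < x →
      Real.log ((x + l) * (Real.log (1 + x / l) - Real.log (1 + x / (l + 1))) /
        Real.log (1 + x / (l + 1))) / Real.log (1 + x / l) = w x := by
  obtain ⟨g, hg, hg0, hg', hlog⟩ := exists_analyticAt_log_one_add_eq_mul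
  have hl1 : 0 < l + 1 := by linarith
  have hscale : ∀ k : ℝ, AnalyticAt ℝ (fun x => g (x / k)) 0 := fun k =>
    AnalyticAt.fun_comp (by simpa using hg) (analyticAt_id.div_const)
  have hscale' : ∀ k : ℝ, HasDerivAt (fun x => g (x / k)) (-1 / 2 * (1 / k)) 0 := fun k =>
    HasDerivAt.comp 0 (h₂ := g) (by simpa using hg') ((hasDerivAt_id (0 : ℝ)).div_const k)
  set R : ℝ → ℝ := fun x =>
    (x + l) * (g (x / l) / l - g (x / (l + 1)) / (l + 1)) / (g (x / (l + 1)) / (l + 1)) with hR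
  have hRan : AnalyticAt ℝ R 0 :=
    ((analyticAt_id.add analyticAt_const).mul
      ((hscale l).div_const.sub (hscale (l + 1)).div_const)).div (hscale (l + 1)).div_const
      (by simp [hg0, hl1.ne'])
  have hR0 : R 0 = 1 := by
    simp only [hR, zero_div, hg0]
    field_simp
    ring
  have hR' : HasDerivAt R (1 / (2 * l)) 0 := by
    have h := ((((hasDerivAt_id (0 : ℝ)).add_const l).mul
      (((hscale' l).div_const l).sub ((hscale' (l + 1)).div_const (l + 1)))).div
      ((hscale' (l + 1)).div_const (l + 1)) (by simp [hg0, hl1.ne']))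
    refine h.congr_deriv ?_
    simp [hg0]
    field_simp
    ring
  obtain ⟨S, hS, hS0, hRS⟩ := (hRan.log (by simp [hR0])).exists_eq_add_mul
  simp only [hR0, Real.log_one, zero_add] at hRS
  rw [(hR'.log (by simp [hR0])).deriv, hR0] at hS0
  refine ⟨fun x => S x / (g (x / l) / l), hS.div (hscale l).div_const (by simp [hg0, hl.ne']),
    ?_, fun x hx => ?_⟩
  · simp only [zero_div, hg0, hS0]
    field_simp
  · have e : (x + l) * (Real.log (1 + x / l) - Real.log (1 + x / (l + 1))) /
        Real.log (1 + x / (l + 1)) = R x := by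
      rw [hlog, hlog, hR]
      rw [show (x + l) * (x / l * g (x / l) - x / (l + 1) * g (x / (l + 1))) =
          x * ((x + l) * (g (x / l) / l - g (x / (l + 1)) / (l + 1))) by ring,
        show x / (l + 1) * g (x / (l + 1)) = x * (g (x / (l + 1)) / (l + 1)) by ring,
        mul_div_mul_left _ _ hx.ne']
    rw [e, hRS, hlog, show x / l * g (x / l) = x * (g (x / l) / l) by ring,
      mul_div_mul_left _ _ hx.ne']

theorem stmt_12 (lw : ℝ) (hw : 0 < lw)
    (p : ℝ) (hp : p = 1 / (lw + 1))
    (q b c v F1 F2 : ℝ → ℝ)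
    (hq : ∀ x, q x = 1 / (x + lw + 1))
    (hb : ∀ x, b x = (x + lw) / lw)
    (hc : ∀ x, c x = (lw + 1) / (x + lw + 1))
    (hv : ∀ x, v x = Real.log ((x + lw) * Real.log (b x * c x) / Real.log (1 / c x))
        / Real.log (b x))
    (hF1 : ∀ x, F1 x = p ^ v x * q x ^ (1 - v x))
    (hF2 : ∀ x, F2 x = (1 - p) ^ v x * (1 - q x) ^ (1 - v x)) :
    (∃ δ > (0 : ℝ), ∀ x ∈ Set.Ioo (0 : ℝ) δ,
        DifferentiableAt ℝ F1 x ∧ DifferentiableAt ℝ F2 x) ∧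
      Tendsto (deriv F1) (nhdsWithin 0 (Set.Ioi 0)) (nhds (-(p ^ 2) / 2)) ∧
      Tendsto (deriv F2) (nhdsWithin 0 (Set.Ioi 0)) (nhds (p ^ 2 / 2)) := by
  have hl1 : 0 < lw + 1 := by linarith
  obtain ⟨w, hwan, hw0, hwv⟩ := exists_analyticAt_exponent hw
  have hvw : ∀ x, 0 < x → v x = w x := by
    intro x hx
    have hbx : b x = 1 + x / lw := by rw [hb]; field_simp; ring
    have hcx : 1 / c x = 1 + x / (lw + 1) := by rw [hc]; field_simp; ring
    have hbpos : b x ≠ 0 := by rw [hbx]; positivity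
    have hcpos : c x ≠ 0 := by rw [hc]; positivity
    have hlogc : Real.log (c x) = -Real.log (1 / c x) := by simp
    rw [hv, Real.log_mul hbpos hcpos, hlogc, hbx, hcx, ← sub_eq_add_neg, hwv x hx]
  have hp0 : 0 < p := by rw [hp]; positivity
  have hp1 : 0 < 1 - p := by
    rw [hp, show 1 - 1 / (lw + 1) = lw / (lw + 1) by field_simp; ring]; positivity
  have hq0 : q 0 = p := by rw [hq, hp, zero_add]
  have hqfun : q = fun x => 1 / (x + lw + 1) := funext hq
  have hqan : AnalyticAt ℝ q 0 := by
    rw [hqfun]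
    exact analyticAt_const.div ((analyticAt_id.add analyticAt_const).add analyticAt_const)
      (by simp [hl1.ne'])
  have hq' : HasDerivAt q (-(p ^ 2)) 0 := by
    have h := (((hasDerivAt_id (0 : ℝ)).add_const lw).add_const 1).inv (by simp [hl1.ne'])
    rw [hqfun]
    simp only [one_div]
    refine h.congr_deriv ?_
    rw [hp]
    simp only [id, zero_add]
    field_simp
  obtain ⟨hG1, hG1'⟩ := analyticAt_rpow_mul_rpow_one_sub hp0 hwan hqan hq0 hq'
  obtain ⟨hG2, hG2'⟩ := analyticAt_rpow_mul_rpow_one_sub (r := fun x => 1 - q x) hp1 hwan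
    (analyticAt_const.sub hqan) (by rw [hq0]) (hq'.const_sub 1)
  obtain ⟨hd1, ht1⟩ := tendsto_deriv_of_eventuallyEq_nhdsGT (F := F1) hG1 (by
    filter_upwards [self_mem_nhdsWithin] with x hx
    rw [hF1, hvw x hx])
  obtain ⟨hd2, ht2⟩ := tendsto_deriv_of_eventuallyEq_nhdsGT (F := F2) hG2 (by
    filter_upwards [self_mem_nhdsWithin] with x hx
    rw [hF2, hvw x hx])
  rw [hG1', hw0] at ht1
  rw [hG2', hw0] at ht2
  refine ⟨?_, ?_, ?_⟩
  · obtain ⟨δ, hδ, h⟩ := mem_nhdsGT_iff_exists_Ioo_subset.1 (hd1.and hd2)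
    exact ⟨δ, hδ, fun x hx => h hx⟩
  · convert ht1 using 2
    ring
  · convert ht2 using 2
    ring
end

section
/- Fix λ_w > 0 and set μ = 1, p = 1/(λ_w+1). For x > 0 define q(x) = 1/(x+λ_w+1), v(x) = log((x+λ_w)·log(b(x)·c(x))/log(1/c(x)))/log(b(x)) with b(x) = (x+λ_w)/λ_w and c(x) = (λ_w+1)/(x+λ_w+1), and F(x) = p^{v(x)}·q(x)^{1−v(x)} + (1−p)^{v(x)}·(1−q(x))^{1−v(x)}. Then F is twice differentiable on a right neighborhood of 0 and F″(x) → −p³/(4(1−p)) = −1/(4·λ_w·(λ_w+1)²) as x → 0 from the right. -/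
open Real Filter

/-- An analytic function vanishing at `0` is `x` times an analytic function. -/
lemma exists_analyticAt_mul_eq {f : ℝ → ℝ} {a : ℝ} (hf : AnalyticAt ℝ f 0) (h0 : f 0 = 0)
    (hd : HasDerivAt f a 0) :
    ∃ g : ℝ → ℝ, AnalyticAt ℝ g 0 ∧ g 0 = a ∧ ∀ x, x * g x = f x := by
  obtain ⟨P, hP⟩ := hf
  refine ⟨dslope f 0, ⟨_, hP.has_fpower_series_dslope_fslope⟩, by simp [hd.deriv], fun x => ?_⟩
  simpa [h0] using sub_smul_dslope f 0 x

lemma analyticAt_log_add {a : ℝ} (ha : 0 < a) : AnalyticAt ℝ (fun x => log (x + a)) 0 :=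
  (analyticAt_id.add analyticAt_const).log (by simpa using ha)

lemma hasDerivAt_log_add {a x : ℝ} (h : x + a ≠ 0) :
    HasDerivAt (fun x => log (x + a)) (1 / (x + a)) x :=
  ((hasDerivAt_id x).add_const a).log h

lemma hasDerivAt_one_div_add {a x : ℝ} (h : x + a ≠ 0) :
    HasDerivAt (fun x => 1 / (x + a)) (-1 / (x + a) ^ 2) x := by
  simpa only [one_div, id] using ((hasDerivAt_id x).add_const a).fun_inv h

/-- The ratio `log (1 + x / (l + 1)) / log (1 + x / l)` extends analytically across `0`. -/
lemma exists_analyticAt_log_ratio {l : ℝ} (hl : 0 < l) :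
    ∃ r : ℝ → ℝ, AnalyticAt ℝ r 0 ∧ r 0 = l / (l + 1) ∧ deriv r 0 = 1 / (2 * (l + 1) ^ 2) ∧
      ∀ᶠ x in nhds 0,
        r x * (log (x + l) - log l) = log (x + (l + 1)) - log (l + 1) := by
  have key : ∀ a : ℝ, 0 < a → ∃ g : ℝ → ℝ, AnalyticAt ℝ g 0 ∧ g 0 = 1 / a ∧
      ∀ x, x * g x = log (x + a) - log a := fun a ha =>
    exists_analyticAt_mul_eq ((analyticAt_log_add ha).sub analyticAt_const) (by simp)
      (by simpa only [zero_add] using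
        (hasDerivAt_log_add (a := a) (x := 0) (by simpa using ha.ne')).sub_const (log a))
  obtain ⟨β, hβ, hβ0, hβx⟩ := key l hl
  obtain ⟨γ, hγ, hγ0, hγx⟩ := key (l + 1) (by linarith)
  have hβne : β 0 ≠ 0 := by rw [hβ0]; positivity
  have hr : AnalyticAt ℝ (fun x => γ x / β x) 0 := hγ.div hβ hβne
  set r : ℝ → ℝ := fun x => γ x / β x with hrdef
  have hr0 : r 0 = l / (l + 1) := by simp only [hrdef, hβ0, hγ0]; field_simp
  have hmul : ∀ᶠ x in nhds 0,
      r x * (log (x + l) - log l) = log (x + (l + 1)) - log (l + 1) := by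
    filter_upwards [hβ.continuousAt.eventually_ne hβne] with x hx
    rw [← hβx, ← hγx]
    simp only [hrdef]
    field_simp
  refine ⟨r, hr, hr0, ?_, hmul⟩
  have hpos : ∀ᶠ x : ℝ in nhds 0, 0 < x + l :=
    (continuousAt_id.add continuousAt_const).eventually (lt_mem_nhds (by simpa using hl))
  have hmul' : (fun x => deriv r x * (log (x + l) - log l) + r x * (1 / (x + l))) =ᶠ[nhds 0]
      fun x => 1 / (x + (l + 1)) := by
    filter_upwards [hmul.eventually_nhds, hpos, hr.eventually_analyticAt] with x hx hxl hrx
    refine HasDerivAt.unique (hrx.differentiableAt.hasDerivAt.mul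
      ((hasDerivAt_log_add hxl.ne').sub_const _)) ?_
    exact ((hasDerivAt_log_add (by linarith : x + (l + 1) ≠ 0)).sub_const _).congr_of_eventuallyEq hx
  have h0 : (0 : ℝ) + l ≠ 0 := by linarith
  have h := HasDerivAt.unique
    ((hr.deriv.differentiableAt.hasDerivAt.mul ((hasDerivAt_log_add h0).sub_const _)).add
      (hr.differentiableAt.hasDerivAt.mul (hasDerivAt_one_div_add h0)))
    ((hasDerivAt_one_div_add (by linarith : (0 : ℝ) + (l + 1) ≠ 0)).congr_of_eventuallyEq hmul')
  simp only [zero_add, sub_self, mul_zero, hr0] at h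
  field_simp at h ⊢
  linarith

/-- Second derivative at a critical point of the exponent. -/
lemma deriv_deriv_exp_of_critical {φ φ' : ℝ → ℝ} {s : ℝ} (h0 : φ 0 = 0)
    (hφ : ∀ᶠ x in nhds 0, HasDerivAt φ (φ' x) x) (h1 : φ' 0 = 0) (hφ' : HasDerivAt φ' s 0) :
    deriv (deriv fun x => exp (φ x)) 0 = s := by
  have h : deriv (fun x => exp (φ x)) =ᶠ[nhds 0] fun x => exp (φ x) * φ' x := by
    filter_upwards [hφ] with x hx using hx.exp.deriv
  rw [h.deriv_eq, (hφ.self_of_nhds.exp.fun_mul hφ').deriv]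
  simp [h0, h1]

/-- The exponent `r log (x + l) + H(r) - log (x + l + 1)` at `r = r x`, with `H` the binary
entropy. -/
noncomputable def entropyExponent (l : ℝ) (r : ℝ → ℝ) (x : ℝ) : ℝ :=
  r x * log (x + l) - (1 - r x) * log (1 - r x) - r x * log (r x) - log (x + (l + 1))

lemma analyticAt_entropyExponent {l : ℝ} (hl : 0 < l) {r : ℝ → ℝ} (hr : AnalyticAt ℝ r 0)
    (h0 : 0 < r 0) (h1 : r 0 < 1) : AnalyticAt ℝ (entropyExponent l r) 0 := by
  have h1r : AnalyticAt ℝ (fun x => 1 - r x) 0 := analyticAt_const.sub hr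
  exact (((hr.mul (analyticAt_log_add hl)).sub (h1r.mul (h1r.log (sub_pos.2 h1)))).sub
    (hr.mul (hr.log h0))).sub (analyticAt_log_add (by linarith))

lemma hasDerivAt_entropyExponent {l x r' : ℝ} {r : ℝ → ℝ} (hr : HasDerivAt r r' x)
    (h0 : 0 < r x) (h1 : r x < 1) (hx : 0 < x + l) :
    HasDerivAt (entropyExponent l r)
      (r' * (log (x + l) + log (1 - r x) - log (r x)) + r x * (1 / (x + l))
        - 1 / (x + (l + 1))) x := by
  have h1' : 1 - r x ≠ 0 := (sub_pos.2 h1).ne'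
  have h1r : HasDerivAt (fun x => 1 - r x) (-r') x := by simpa using hr.const_sub 1
  have := (((hr.mul (hasDerivAt_log_add hx.ne')).sub (h1r.mul (h1r.log h1'))).sub
    (hr.mul (hr.log h0.ne'))).sub
      (hasDerivAt_log_add (a := l + 1) (x := x) (by linarith))
  refine this.congr_deriv ?_
  rw [mul_div_cancel₀ _ h1', mul_div_cancel₀ _ h0.ne']
  ring

lemma deriv_deriv_exp_entropyExponent {l : ℝ} (hl : 0 < l) {r : ℝ → ℝ} (hr : AnalyticAt ℝ r 0)
    (hr0 : r 0 = l / (l + 1)) (hr1 : deriv r 0 = 1 / (2 * (l + 1) ^ 2)) :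
    deriv (deriv fun x => exp (entropyExponent l r x)) 0 = -1 / (4 * l * (l + 1) ^ 2) := by
  have hl1 : 0 < l + 1 := by linarith
  have h0 : 0 < r 0 := by rw [hr0]; positivity
  have hsub : 1 - r 0 = 1 / (l + 1) := by rw [hr0]; field_simp; ring
  have h1 : r 0 < 1 := by rw [← sub_pos, hsub]; positivity
  have hlog : log (r 0) = log l - log (l + 1) := by rw [hr0, log_div hl.ne' hl1.ne']
  have hlog1 : log (1 - r 0) = -log (l + 1) := by rw [hsub]; simp
  have hcancel : log l + log (1 - r 0) - log (r 0) = 0 := by rw [hlog, hlog1]; ring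
  have hne : (0 : ℝ) + l ≠ 0 := by linarith
  refine deriv_deriv_exp_of_critical (φ' := fun x =>
    deriv r x * (log (x + l) + log (1 - r x) - log (r x)) + r x * (1 / (x + l))
      - 1 / (x + (l + 1))) ?_ ?_ ?_ ?_
  · simp only [entropyExponent, hlog, hlog1, zero_add]; ring
  · filter_upwards [hr.eventually_analyticAt, hr.continuousAt.eventually (lt_mem_nhds h0),
      hr.continuousAt.eventually (gt_mem_nhds h1),
      (continuousAt_id.add continuousAt_const).eventually
        (lt_mem_nhds (by simpa using hl) : ∀ᶠ y in nhds ((0 : ℝ) + l), 0 < y)] with x hx hx0 hx1 hxl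
    exact hasDerivAt_entropyExponent hx.differentiableAt.hasDerivAt hx0 hx1 hxl
  · simp only [zero_add, hcancel]
    rw [hr0]
    field_simp
    ring
  · have hrd := hr.differentiableAt.hasDerivAt
    have h1r : HasDerivAt (fun x => 1 - r x) (-deriv r 0) 0 := by simpa using hrd.const_sub 1
    have := (((hr.deriv.differentiableAt.hasDerivAt.mul
      (((hasDerivAt_log_add hne).add (h1r.log (sub_pos.2 h1).ne')).sub (hrd.log h0.ne'))).add
      (hrd.mul (hasDerivAt_one_div_add hne))).sub
      (hasDerivAt_one_div_add (a := l + 1) (x := 0) (by linarith)))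
    refine this.congr_deriv ?_
    simp only [Pi.add_apply, Pi.sub_apply, zero_add, hcancel]
    rw [hsub, hr1, hr0]
    field_simp
    ring

/-- The spectral-radius function equals the exponential of `entropyExponent`. -/
lemma spectralRadius_eq_exp_entropyExponent {l x v : ℝ} {r : ℝ → ℝ} (hl : 0 < l) (hx : 0 < x)
    (h0 : 0 < r x) (h1 : r x < 1)
    (hr : r x * (log (x + l) - log l) = log (x + (l + 1)) - log (l + 1))
    (hv : v = log ((x + l) * log ((x + l) / l * ((l + 1) / (x + l + 1))) /
      log (1 / ((l + 1) / (x + l + 1)))) / log ((x + l) / l)) :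
    (1 / (l + 1)) ^ v * (1 / (x + l + 1)) ^ (1 - v) +
      (1 - 1 / (l + 1)) ^ v * (1 - 1 / (x + l + 1)) ^ (1 - v) = exp (entropyExponent l r x) := by
  have hl1 : 0 < l + 1 := by linarith
  have hxl : 0 < x + l := by linarith
  have hxl1 : 0 < x + l + 1 := by linarith
  rw [← add_assoc] at hr
  have hB : 0 < log (x + l) - log l := sub_pos.2 (log_lt_log hl (by linarith))
  set B := log (x + l) - log l with hBdef
  set ρ := r x with hρ
  have hr1 : 0 < 1 - ρ := sub_pos.2 h1
  have hvB : v * B = log (x + l) + log (1 - ρ) - log ρ := by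
    have e1 : log ((x + l) / l) = B := log_div hxl.ne' hl.ne'
    have e2 : log ((l + 1) / (x + l + 1)) = -(ρ * B) := by
      rw [log_div hl1.ne' hxl1.ne', hr]; ring
    have e3 : log (1 / ((l + 1) / (x + l + 1))) = ρ * B := by
      rw [one_div, log_inv, e2, neg_neg]
    have e4 : log ((x + l) / l * ((l + 1) / (x + l + 1))) = (1 - ρ) * B := by
      rw [log_mul (by positivity) (by positivity), e1, e2]; ring
    have e5 : (x + l) * ((1 - ρ) * B) / (ρ * B) = (x + l) * (1 - ρ) / ρ := by
      field_simp
    rw [hv, e1, e3, e4, e5, div_mul_cancel₀ _ hB.ne', log_div (by positivity) h0.ne',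
      log_mul hxl.ne' hr1.ne']
  have p1 : (1 : ℝ) - 1 / (l + 1) = l / (l + 1) := by field_simp; ring
  have q1 : (1 : ℝ) - 1 / (x + l + 1) = (x + l) / (x + l + 1) := by field_simp; ring
  have hE : entropyExponent l r x = ρ * (v * B) - log (1 - ρ) - log (x + l + 1) := by
    rw [hvB, entropyExponent, ← hρ, ← add_assoc]; ring
  have t1 : (1 / (l + 1)) ^ v * (1 / (x + l + 1)) ^ (1 - v) =
      exp (entropyExponent l r x) * (1 - ρ) := by
    rw [rpow_def_of_pos (by positivity), rpow_def_of_pos (by positivity), ← exp_add, hE]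
    conv_rhs => rw [← exp_log hr1, ← exp_add, exp_log hr1]
    congr 1
    rw [log_div one_ne_zero hl1.ne', log_div one_ne_zero hxl1.ne', log_one]
    linear_combination -v * hr
  have t2 : (1 - 1 / (l + 1)) ^ v * (1 - 1 / (x + l + 1)) ^ (1 - v) =
      exp (entropyExponent l r x) * ρ := by
    rw [p1, q1, rpow_def_of_pos (by positivity), rpow_def_of_pos (by positivity), ← exp_add, hE]
    conv_rhs => rw [← exp_log h0, ← exp_add, exp_log h0]
    congr 1
    rw [log_div hl.ne' hl1.ne', log_div hxl.ne' hxl1.ne']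
    linear_combination -v * hr - hvB + v * hBdef
  rw [t1, t2]
  ring

theorem stmt_14 (lw : ℝ) (hw : 0 < lw)
    (p : ℝ) (hp : p = 1 / (lw + 1))
    (q b c v F : ℝ → ℝ)
    (hq : ∀ x, q x = 1 / (x + lw + 1))
    (hb : ∀ x, b x = (x + lw) / lw)
    (hc : ∀ x, c x = (lw + 1) / (x + lw + 1))
    (hv : ∀ x, v x = Real.log ((x + lw) * Real.log (b x * c x) / Real.log (1 / c x))
        / Real.log (b x))
    (hF : ∀ x, F x = p ^ v x * q x ^ (1 - v x) + (1 - p) ^ v x * (1 - q x) ^ (1 - v x)) :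
    (∃ δ > (0 : ℝ), ∀ x ∈ Set.Ioo (0 : ℝ) δ,
        DifferentiableAt ℝ F x ∧ DifferentiableAt ℝ (deriv F) x) ∧
      Tendsto (deriv (deriv F)) (nhdsWithin 0 (Set.Ioi 0))
        (nhds (-(p ^ 3) / (4 * (1 - p)))) ∧
      -(p ^ 3) / (4 * (1 - p)) = -1 / (4 * lw * (lw + 1) ^ 2) := by
  have hl1 : 0 < lw + 1 := by linarith
  have hval : -(p ^ 3) / (4 * (1 - p)) = -1 / (4 * lw * (lw + 1) ^ 2) := by
    have : 1 - p = lw / (lw + 1) := by rw [hp]; field_simp; ring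
    rw [this, hp]
    field_simp
  obtain ⟨r, hr, hr0, hr1, hrx⟩ := exists_analyticAt_log_ratio hw
  have h0 : 0 < r 0 := by rw [hr0]; positivity
  have h1 : r 0 < 1 := by rw [hr0, div_lt_one hl1]; linarith
  have hG : AnalyticAt ℝ (fun x => exp (entropyExponent lw r x)) 0 :=
    (analyticAt_entropyExponent hw hr h0 h1).rexp
  set G : ℝ → ℝ := fun x => exp (entropyExponent lw r x) with hGdef
  have hev : ∀ᶠ x in nhds 0, AnalyticAt ℝ G x ∧ (0 < x → F x = G x) := by
    filter_upwards [hG.eventually_analyticAt, hrx, hr.continuousAt.eventually (lt_mem_nhds h0),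
      hr.continuousAt.eventually (gt_mem_nhds h1)] with x hGx hx hx0 hx1
    refine ⟨hGx, fun hpos => ?_⟩
    rw [hF, hp, hq]
    exact spectralRadius_eq_exp_entropyExponent hw hpos hx0 hx1 hx (by rw [hv, hb, hc])
  have hnhds : ∀ᶠ x in nhds 0, 0 < x → AnalyticAt ℝ G x ∧ F =ᶠ[nhds x] G := by
    filter_upwards [hev.eventually_nhds] with x hx hpos
    refine ⟨hx.self_of_nhds.1, ?_⟩
    filter_upwards [hx, lt_mem_nhds hpos] with y hy hy0 using hy.2 hy0
  refine ⟨?_, ?_, hval⟩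
  · obtain ⟨δ, hδ, h⟩ := Metric.eventually_nhds_iff.1 hnhds
    refine ⟨δ, hδ, fun x hx => ?_⟩
    obtain ⟨hGx, hFG⟩ := h (by simpa [abs_of_pos hx.1] using hx.2) hx.1
    exact ⟨hFG.differentiableAt_iff.2 hGx.differentiableAt,
      hFG.deriv.differentiableAt_iff.2 hGx.deriv.differentiableAt⟩
  · rw [hval, ← deriv_deriv_exp_entropyExponent hw hr hr0 hr1]
    refine (hG.deriv.deriv.continuousAt.tendsto.mono_left nhdsWithin_le_nhds).congr' ?_
    filter_upwards [nhdsWithin_le_nhds hnhds, self_mem_nhdsWithin] with x hx hpos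
    exact ((hx hpos).2.deriv.deriv_eq).symm
end
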